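/- Let p ≥ 1 and m > 0. Let T = (t_{ij}) be a random p×p lower triangular matrix whose entries on and below the diagonal are independent, with t_{ij} ~ N(0,1) for i > j and with t_{ii} ≥ 0 such that t_{ii}² has the chi-squared distribution with m + p − i degrees of freedom (i.e. the Gamma distribution with shape (m+p−i)/2 and rate 1/2), for i = 1,…,p. Then for every fixed z = (z₁,…,z_p)′ ∈ ℝ^p: E[ (z′ T′ T z)² ] = (m+2p+2)(m+2p)·(Σ_{i=1}^p zᵢ²)² − 2(m+2p+2)·Σ_{i,j=1}^p max(i,j)·zᵢ² zⱼ² − 2(m+2p)·Σ_{i,j=1}^p min(i,j)·zᵢ² zⱼ² + 4·(Σ_{i=1}^p i·zᵢ²)². -/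

import Mathlib

open MeasureTheory ProbabilityTheory

/-- Index set of the on-or-below-diagonal entries of a `p × p` matrix. -/
abbrev LowIdx (p : ℕ) := {q : Fin p × Fin p // q.2 ≤ q.1}

/-- The lower triangular matrix built from its on-or-below-diagonal entries. -/
def lowMat (p : ℕ) (t : LowIdx p → ℝ) : Matrix (Fin p) (Fin p) ℝ :=
  Matrix.of fun i j => if h : j ≤ i then t ⟨(i, j), h⟩ else 0

/-- The law of the random lower triangular matrix `T`: the on-or-below-diagonal entries
are independent, the diagonal entry `t_{ii}` (1-based `i`) is `χ_{m+p-i}`-distributed (the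
square root of a Gamma((m+p-i)/2, 1/2), i.e. chi-squared, variable) and the strictly lower
entries are standard normal. -/
noncomputable def lowTriLaw (p : ℕ) (m : ℝ) : Measure (LowIdx p → ℝ) :=
  Measure.pi fun q : LowIdx p =>
    if q.1.2 = q.1.1 then
      Measure.map Real.sqrt (gammaMeasure ((m + (p : ℝ) - ((q.1.1 : ℕ) + 1)) / 2) (1 / 2))
    else gaussianReal 0 1

lemma measurable_gammaPDF (a r : ℝ) : Measurable (gammaPDF a r) :=
  (measurable_gammaPDFReal a r).ennreal_ofReal

lemma integral_pow_gaussianReal_zero_one :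
    (∫ x, x ∂gaussianReal 0 1 = 0) ∧ (∫ x, x ^ 2 ∂gaussianReal 0 1 = 1) ∧
      (∫ x, x ^ 3 ∂gaussianReal 0 1 = 0) ∧ (∫ x, x ^ 4 ∂gaussianReal 0 1 = 3) := by
  have h0 : (0 : ℝ) ∈ interior (integrableExpSet id (gaussianReal 0 1)) := by
    simp [integrableExpSet_id_gaussianReal]
  have d0 : ∀ t : ℝ, HasDerivAt (fun t : ℝ => Real.exp (t ^ 2 / 2))
      (t * Real.exp (t ^ 2 / 2)) t := fun t => by
    have h := (((hasDerivAt_id t).pow 2).div_const 2).exp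
    refine h.congr_deriv ?_
    simp [mul_comm]
  have e0 : mgf id (gaussianReal 0 1) = fun t : ℝ => Real.exp (t ^ 2 / 2) := by
    rw [mgf_id_gaussianReal]; simp
  have e1 : iteratedDeriv 1 (mgf id (gaussianReal 0 1)) =
      fun t : ℝ => t * Real.exp (t ^ 2 / 2) := by
    rw [iteratedDeriv_one, e0]; exact funext fun t => (d0 t).deriv
  have e2 : iteratedDeriv 2 (mgf id (gaussianReal 0 1)) =
      fun t : ℝ => (1 + t ^ 2) * Real.exp (t ^ 2 / 2) := by
    rw [iteratedDeriv_succ, e1]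
    refine funext fun t => (((hasDerivAt_id t).mul (d0 t)).congr_deriv ?_).deriv
    simp; ring
  have e3 : iteratedDeriv 3 (mgf id (gaussianReal 0 1)) =
      fun t : ℝ => (3 * t + t ^ 3) * Real.exp (t ^ 2 / 2) := by
    rw [iteratedDeriv_succ, e2]
    refine funext fun t =>
      (((((hasDerivAt_id t).pow 2).const_add 1).mul (d0 t)).congr_deriv ?_).deriv
    simp; ring
  have e4 : iteratedDeriv 4 (mgf id (gaussianReal 0 1)) =
      fun t : ℝ => (3 + 6 * t ^ 2 + t ^ 4) * Real.exp (t ^ 2 / 2) := by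
    rw [iteratedDeriv_succ, e3]
    refine funext fun t =>
      (((((hasDerivAt_id t).const_mul 3).add ((hasDerivAt_id t).pow 3)).mul
        (d0 t)).congr_deriv ?_).deriv
    simp; ring
  refine ⟨by simp, ?_, ?_, ?_⟩
  · simpa [e2] using (iteratedDeriv_mgf_zero h0 2).symm
  · simpa [e3] using (iteratedDeriv_mgf_zero h0 3).symm
  · simpa [e4] using (iteratedDeriv_mgf_zero h0 4).symm

lemma integrable_pow_gaussianReal (μ : ℝ) (v : NNReal) (k : ℕ) :
    Integrable (fun x : ℝ => x ^ k) (gaussianReal μ v) := by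
  have h := memLp_id_gaussianReal' (μ := μ) (v := v) k (by simp)
  refine ((h.integrable_norm_pow' ).mono (by fun_prop) (by simp))

lemma integral_gammaMeasure {a r : ℝ} (ha : 0 < a) (hr : 0 < r) (f : ℝ → ℝ) :
    ∫ x, f x ∂gammaMeasure a r =
      ∫ x in Set.Ioi 0, r ^ a / Real.Gamma a * (x ^ (a - 1) * Real.exp (-(r * x)) * f x) := by
  rw [gammaMeasure, integral_withDensity_eq_integral_toReal_smul
    (measurable_gammaPDF a r) (by simp [gammaPDF]),
    ← integral_Ici_eq_integral_Ioi, ← integral_indicator measurableSet_Ici]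
  congr 1 with x
  by_cases hx : 0 ≤ x
  · simp only [gammaPDF, smul_eq_mul, Set.indicator, Set.mem_Ici, hx, if_true,
      ENNReal.toReal_ofReal (gammaPDFReal_nonneg ha hr x)]
    simp only [gammaPDFReal, hx, if_true]
    ring
  · simp [gammaPDF, gammaPDFReal, Set.indicator, hx]

lemma integrable_rpow_gammaMeasure {a r s : ℝ} (ha : 0 < a) (hr : 0 < r) (hs : 0 ≤ s) :
    Integrable (fun x : ℝ => x ^ s) (gammaMeasure a r) := by
  rw [gammaMeasure, integrable_withDensity_iff_integrable_smul'
    (measurable_gammaPDF a r) (by simp [gammaPDF])]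
  have h : IntegrableOn (fun x : ℝ => r ^ a / Real.Gamma a *
      (x ^ (a - 1 + s) * Real.exp (-r * x))) (Set.Ioi 0) := by
    have := integrableOn_rpow_mul_exp_neg_mul_rpow (p := 1) (s := a - 1 + s) (b := r)
      (by linarith) one_pos hr
    simpa [IntegrableOn] using this.const_mul (r ^ a / Real.Gamma a)
  rw [← integrable_indicator_iff measurableSet_Ioi] at h
  refine h.congr ?_
  filter_upwards [compl_mem_ae_iff.2 (measure_singleton (μ := volume) (0 : ℝ))] with x hx0
  have hx0 : x ≠ 0 := by simpa using hx0
  by_cases hx : 0 < x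
  · simp only [gammaPDF, smul_eq_mul, Set.indicator, Set.mem_Ioi, hx, if_true,
      ENNReal.toReal_ofReal (gammaPDFReal_nonneg ha hr x)]
    simp only [gammaPDFReal, hx.le, if_true, Real.rpow_add hx, neg_mul]
    ring
  · have hx' : ¬ 0 ≤ x := fun h => hx (lt_of_le_of_ne h hx0.symm)
    simp [gammaPDF, gammaPDFReal, Set.indicator, hx, hx']

lemma integral_rpow_gammaMeasure {a r s : ℝ} (ha : 0 < a) (hr : 0 < r) (hs : 0 ≤ s) :
    ∫ x, x ^ s ∂gammaMeasure a r = Real.Gamma (a + s) / Real.Gamma a / r ^ s := by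
  rw [integral_gammaMeasure ha hr, integral_const_mul]
  have h : ∀ x ∈ Set.Ioi (0 : ℝ), x ^ (a - 1) * Real.exp (-(r * x)) * x ^ s =
      x ^ (a + s - 1) * Real.exp (-(r * x)) := fun x hx => by
    rw [show a + s - 1 = a - 1 + s by ring, Real.rpow_add hx]; ring
  rw [setIntegral_congr_fun measurableSet_Ioi h,
    Real.integral_rpow_mul_exp_neg_mul_Ioi (by linarith) hr, one_div, Real.inv_rpow hr.le,
    Real.rpow_add hr]
  have := (Real.Gamma_pos_of_pos ha).ne'
  have := (Real.rpow_pos_of_pos hr a).ne'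
  have := (Real.rpow_pos_of_pos hr s).ne'
  field_simp

lemma integrable_pow_map_sqrt_gammaMeasure {a r : ℝ} (ha : 0 < a) (hr : 0 < r) (k : ℕ) :
    Integrable (fun x : ℝ => x ^ k) ((gammaMeasure a r).map Real.sqrt) := by
  rw [integrable_map_measure (by fun_prop) (by fun_prop)]
  refine (integrable_rpow_gammaMeasure (s := k / 2) ha hr (by positivity)).mono
    (by fun_prop) ?_
  have hp := isProbabilityMeasure_gammaMeasure ha hr
  refine Filter.Eventually.of_forall fun x => ?_
  by_cases hx : 0 ≤ x
  · simp [Real.sqrt_eq_rpow, ← Real.rpow_natCast, ← Real.rpow_mul hx]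
    ring_nf; rfl
  · rcases k.eq_zero_or_pos with rfl | hk
    · simp
    · simp [Real.sqrt_eq_zero_of_nonpos (not_le.1 hx).le, hk.ne']

lemma gammaMeasure_nonneg_ae (a r : ℝ) : ∀ᵐ x ∂gammaMeasure a r, 0 ≤ x := by
  rw [gammaMeasure, ae_withDensity_iff (measurable_gammaPDF a r)]
  refine Filter.Eventually.of_forall fun x hx => ?_
  by_contra h
  exact hx (gammaPDF_of_neg (not_le.1 h))

lemma integral_sq_map_sqrt_gammaMeasure {a r : ℝ} (ha : 0 < a) (hr : 0 < r) :
    ∫ x, x ^ 2 ∂(gammaMeasure a r).map Real.sqrt = a / r := by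
  rw [integral_map (by fun_prop) (by fun_prop)]
  have h : (fun x : ℝ => √x ^ 2) =ᵐ[gammaMeasure a r] fun x => x ^ (1 : ℝ) := by
    filter_upwards [gammaMeasure_nonneg_ae a r] with x hx
    simp [Real.sq_sqrt hx]
  rw [integral_congr_ae h, integral_rpow_gammaMeasure ha hr zero_le_one,
    Real.Gamma_add_one ha.ne', Real.rpow_one, mul_div_cancel_right₀ _ (Real.Gamma_pos_of_pos ha).ne']

lemma integral_pow_four_map_sqrt_gammaMeasure {a r : ℝ} (ha : 0 < a) (hr : 0 < r) :
    ∫ x, x ^ 4 ∂(gammaMeasure a r).map Real.sqrt = a * (a + 1) / r ^ 2 := by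
  rw [integral_map (by fun_prop) (by fun_prop)]
  have h : (fun x : ℝ => √x ^ 4) =ᵐ[gammaMeasure a r] fun x => x ^ (2 : ℝ) := by
    filter_upwards [gammaMeasure_nonneg_ae a r] with x hx
    rw [show 4 = 2 * 2 from rfl, pow_mul, Real.sq_sqrt hx, Real.rpow_two]
  rw [integral_congr_ae h, integral_rpow_gammaMeasure ha hr zero_le_two,
    show a + 2 = a + 1 + 1 by ring, Real.Gamma_add_one (by positivity),
    Real.Gamma_add_one ha.ne', Real.rpow_two]
  have := (Real.Gamma_pos_of_pos ha).ne'
  field_simp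

section IndependentMoments

variable {Ω : Type*} [MeasurableSpace Ω] {μ : Measure Ω} {U V : Ω → ℝ}

lemma ProbabilityTheory.IndepFun.integrable_pow_mul_pow (h : IndepFun U V μ)
    (hU : ∀ k : ℕ, Integrable (fun ω => U ω ^ k) μ)
    (hV : ∀ k : ℕ, Integrable (fun ω => V ω ^ k) μ) (a b : ℕ) :
    Integrable (fun ω => U ω ^ a * V ω ^ b) μ :=
  (h.comp (φ := (· ^ a)) (ψ := (· ^ b)) (by fun_prop) (by fun_prop)).integrable_mul (hU a) (hV b)

lemma ProbabilityTheory.IndepFun.integrable_add_pow (h : IndepFun U V μ)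
    (hU : ∀ k : ℕ, Integrable (fun ω => U ω ^ k) μ)
    (hV : ∀ k : ℕ, Integrable (fun ω => V ω ^ k) μ) (n : ℕ) :
    Integrable (fun ω => (U ω + V ω) ^ n) μ := by
  simp only [add_pow]
  exact integrable_finsetSum _ fun k _ =>
    (h.integrable_pow_mul_pow hU hV k (n - k)).mul_const _

lemma ProbabilityTheory.IndepFun.integral_add_pow (h : IndepFun U V μ)
    (hU : ∀ k : ℕ, Integrable (fun ω => U ω ^ k) μ)
    (hV : ∀ k : ℕ, Integrable (fun ω => V ω ^ k) μ) (n : ℕ) :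
    ∫ ω, (U ω + V ω) ^ n ∂μ = ∑ k ∈ Finset.range (n + 1),
      (∫ ω, U ω ^ k ∂μ) * (∫ ω, V ω ^ (n - k) ∂μ) * (n.choose k : ℝ) := by
  simp only [add_pow]
  rw [integral_finsetSum _ fun k _ => (h.integrable_pow_mul_pow hU hV k (n - k)).mul_const _]
  refine Finset.sum_congr rfl fun k _ => ?_
  rw [integral_mul_const]
  congr 1
  exact (h.comp (φ := (· ^ k)) (ψ := (· ^ (n - k))) (by fun_prop)
    (by fun_prop)).integral_mul_eq_mul_integral (hU k).aestronglyMeasurable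
      (hV (n - k)).aestronglyMeasurable

/-- All powers of `X` are integrable, and the first four moments of `X` are those of the centred
normal distribution with variance `s`. -/
structure HasGaussianMoments (X : Ω → ℝ) (s : ℝ) (μ : Measure Ω) : Prop where
  integrable_pow : ∀ k : ℕ, Integrable (fun ω => X ω ^ k) μ
  integral_one : ∫ ω, X ω ∂μ = 0
  integral_two : ∫ ω, X ω ^ 2 ∂μ = s
  integral_three : ∫ ω, X ω ^ 3 ∂μ = 0
  integral_four : ∫ ω, X ω ^ 4 ∂μ = 3 * s ^ 2

lemma HasGaussianMoments.zero [IsProbabilityMeasure μ] :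
    HasGaussianMoments (fun _ : Ω => (0 : ℝ)) 0 μ :=
  ⟨fun _ => integrable_const _, by simp, by simp, by simp, by simp⟩

lemma HasGaussianMoments.add [IsProbabilityMeasure μ] {s v : ℝ} (hU : HasGaussianMoments U s μ)
    (hV : HasGaussianMoments V v μ) (h : IndepFun U V μ) :
    HasGaussianMoments (fun ω => U ω + V ω) (s + v) μ := by
  have hm := h.integral_add_pow hU.integrable_pow hV.integrable_pow
  refine ⟨h.integrable_add_pow hU.integrable_pow hV.integrable_pow, ?_, ?_, ?_, ?_⟩
  · simpa [Finset.sum_range_succ, hU.integral_one, hV.integral_one] using hm 1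
  all_goals
    rw [hm]
    simp [Finset.sum_range_succ, Nat.choose, hU.integral_one, hV.integral_one, hU.integral_two,
      hV.integral_two, hU.integral_three, hV.integral_three, hU.integral_four, hV.integral_four]
    try ring

lemma HasGaussianMoments.mul_const {s : ℝ} (hU : HasGaussianMoments U s μ) (c : ℝ) :
    HasGaussianMoments (fun ω => U ω * c) (s * c ^ 2) μ := by
  refine ⟨fun k => ?_, ?_, ?_, ?_, ?_⟩
  · simpa only [mul_pow] using (hU.integrable_pow k).mul_const _
  · rw [integral_mul_const, hU.integral_one, zero_mul]
  · simp only [mul_pow, integral_mul_const, hU.integral_two]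
  · simp only [mul_pow, integral_mul_const, hU.integral_three, zero_mul]
  · simp only [mul_pow, integral_mul_const, hU.integral_four]
    ring

lemma HasGaussianMoments.finsetSum [IsProbabilityMeasure μ] {ι : Type*} {X : ι → Ω → ℝ}
    {v : ι → ℝ} (hmeas : ∀ i, Measurable (X i)) (hind : iIndepFun X μ) (S : Finset ι)
    (h : ∀ i ∈ S, HasGaussianMoments (X i) (v i) μ) :
    HasGaussianMoments (fun ω => ∑ i ∈ S, X i ω) (∑ i ∈ S, v i) μ := by
  classical
  induction S using Finset.induction_on with
  | empty => simpa using HasGaussianMoments.zero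
  | insert a S ha ih =>
    have h1 := hind.indepFun_finsetSum_of_notMem hmeas ha
    rw [show (∑ j ∈ S, X j) = fun ω => ∑ j ∈ S, X j ω from funext fun ω => by simp] at h1
    simpa only [Finset.sum_insert ha] using
      (h a (by simp)).add (ih fun i hi => h i (by simp [hi])) h1.symm

/-- If `G` is centred Gaussian up to fourth moments and independent of `R`, and `R` has second
moment `n`, this is the second moment of `G + R * c`. -/
lemma HasGaussianMoments.integral_add_mul_sq [IsProbabilityMeasure μ] {G R : Ω → ℝ} {s n c : ℝ}
    (hG : HasGaussianMoments G s μ) (hR : ∀ k : ℕ, Integrable (fun ω => R ω ^ k) μ)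
    (hind : IndepFun G R μ) (h2 : ∫ ω, R ω ^ 2 ∂μ = n) :
    ∫ ω, (G ω + R ω * c) ^ 2 ∂μ = s + n * c ^ 2 := by
  have hRc : ∀ k : ℕ, Integrable (fun ω => (R ω * c) ^ k) μ := fun k => by
    simpa only [mul_pow] using (hR k).mul_const _
  have hc : IndepFun G (fun ω => R ω * c) μ :=
    hind.comp (φ := id) (ψ := (· * c)) measurable_id (by fun_prop)
  rw [hc.integral_add_pow hG.integrable_pow hRc]
  simp [Finset.sum_range_succ, mul_pow, integral_mul_const, hG.integral_one, hG.integral_two, h2]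
  ring

/-- The companion of `HasGaussianMoments.integral_add_mul_sq` for the fourth moment, when `R` has the
second and fourth moments of the chi distribution with `n` degrees of freedom. -/
lemma HasGaussianMoments.integral_add_mul_pow_four [IsProbabilityMeasure μ] {G R : Ω → ℝ}
    {s n c : ℝ} (hG : HasGaussianMoments G s μ) (hR : ∀ k : ℕ, Integrable (fun ω => R ω ^ k) μ)
    (hind : IndepFun G R μ) (h2 : ∫ ω, R ω ^ 2 ∂μ = n) (h4 : ∫ ω, R ω ^ 4 ∂μ = n * (n + 2)) :
    ∫ ω, (G ω + R ω * c) ^ 4 ∂μ =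
      3 * s ^ 2 + 6 * s * (n * c ^ 2) + n * (n + 2) * c ^ 4 := by
  have hRc : ∀ k : ℕ, Integrable (fun ω => (R ω * c) ^ k) μ := fun k => by
    simpa only [mul_pow] using (hR k).mul_const _
  have hc : IndepFun G (fun ω => R ω * c) μ :=
    hind.comp (φ := id) (ψ := (· * c)) measurable_id (by fun_prop)
  rw [hc.integral_add_pow hG.integrable_pow hRc]
  simp [Finset.sum_range_succ, Nat.choose, mul_pow, integral_mul_const, hG.integral_one,
    hG.integral_two, hG.integral_three, hG.integral_four, h2, h4]
  ring

/-- The second moment of a sum of pairwise independent square-integrable variables. -/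
lemma integral_sum_sq_of_pairwise_indepFun [IsProbabilityMeasure μ] {ι : Type*} [Fintype ι]
    {X : ι → Ω → ℝ} (hX : ∀ i, MemLp (X i) 2 μ) (h : Pairwise fun i j => IndepFun (X i) (X j) μ) :
    ∫ ω, (∑ i, X i ω) ^ 2 ∂μ =
      (∑ i, ∫ ω, X i ω ∂μ) ^ 2 + ∑ i, (∫ ω, X i ω ^ 2 ∂μ - (∫ ω, X i ω ∂μ) ^ 2) := by
  have hv := IndepFun.variance_sum (s := Finset.univ) (fun i _ => hX i)
    (fun i _ j _ hij => h hij)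
  rw [variance_eq_sub (memLp_finsetSum' _ fun i _ => hX i),
    Finset.sum_congr rfl fun i _ => variance_eq_sub (hX i)] at hv
  simp only [Pi.pow_apply, Finset.sum_apply] at hv
  rw [integral_finsetSum _ fun i _ => (hX i).integrable one_le_two] at hv
  linarith

end IndependentMoments

lemma sum_range_partialSum_add (M : ℝ) (w : ℕ → ℝ) (n : ℕ) :
    ∑ i ∈ Finset.range n, (∑ j ∈ Finset.range i, w j + (M - i) * w i) =
      (M + n - 1) * ∑ i ∈ Finset.range n, w i - 2 * ∑ i ∈ Finset.range n, i * w i := by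
  induction n with
  | zero => simp
  | succ n ih =>
    simp only [Finset.sum_range_succ, ih]
    push_cast
    ring

lemma sum_range_partialSum_sq_add (M : ℝ) (w : ℕ → ℝ) (n : ℕ) :
    ∑ i ∈ Finset.range n, ((∑ j ∈ Finset.range i, w j) ^ 2 +
        2 * (∑ j ∈ Finset.range i, w j) * ((M - i) * w i) + (M - i) * w i ^ 2) =
      (M + n - 1) * (∑ i ∈ Finset.range n, w i) ^ 2 -
        2 * ∑ i ∈ Finset.range n, ∑ j ∈ Finset.range n, ((max i j : ℕ) : ℝ) * w i * w j := by
  induction n with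
  | zero => simp
  | succ n ih =>
    have h1 : ∑ i ∈ Finset.range n, ((max i n : ℕ) : ℝ) * w i * w n =
        n * (∑ i ∈ Finset.range n, w i) * w n := by
      rw [Finset.mul_sum, Finset.sum_mul]
      refine Finset.sum_congr rfl fun i hi => ?_
      rw [max_eq_right (Finset.mem_range.1 hi).le]
    have h2 : ∑ i ∈ Finset.range n, ((max n i : ℕ) : ℝ) * w n * w i =
        n * (∑ i ∈ Finset.range n, w i) * w n := by
      rw [← h1]
      refine Finset.sum_congr rfl fun i hi => ?_
      rw [max_comm]; ring
    rw [Finset.sum_range_succ, ih]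
    simp only [Finset.sum_range_succ, Finset.sum_add_distrib, h1, h2, max_self]
    push_cast
    ring

/-- The law of the entry of the random lower triangular matrix at a given position. -/
noncomputable def lowEntryLaw (p : ℕ) (m : ℝ) (q : LowIdx p) : Measure ℝ :=
  if q.1.2 = q.1.1 then
    Measure.map Real.sqrt (gammaMeasure ((m + (p : ℝ) - ((q.1.1 : ℕ) + 1)) / 2) (1 / 2))
  else gaussianReal 0 1

lemma lowTriLaw_eq_pi (p : ℕ) (m : ℝ) : lowTriLaw p m = Measure.pi (lowEntryLaw p m) := rfl

/-- The diagonal position in row `i`. -/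
def diagIdx {p : ℕ} (i : Fin p) : LowIdx p := ⟨(i, i), le_rfl⟩

/-- The positions of row `i`. -/
def rowIdx {p : ℕ} (i : Fin p) : Finset (LowIdx p) := Finset.univ.filter fun q => q.1.1 = i

lemma diagIdx_mem_rowIdx {p : ℕ} (i : Fin p) : diagIdx i ∈ rowIdx i := by
  simp [diagIdx, rowIdx]

lemma disjoint_rowIdx {p : ℕ} {i j : Fin p} (h : i ≠ j) : Disjoint (rowIdx i) (rowIdx j) := by
  rw [Finset.disjoint_left]
  intro q hi hj
  simp only [rowIdx, Finset.mem_filter, Finset.mem_univ, true_and] at hi hj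
  exact h (hi.symm.trans hj)

lemma sum_dite_le_eq_sum_rowIdx {p : ℕ} (f : LowIdx p → ℝ) (i : Fin p) :
    (∑ j, if h : j ≤ i then f ⟨(i, j), h⟩ else 0) = ∑ q ∈ rowIdx i, f q := by
  let F : Fin p × Fin p → ℝ := fun q =>
    if h : q.2 ≤ q.1 then (if q.1 = i then f ⟨q, h⟩ else 0) else 0
  have h1 : ∑ q ∈ rowIdx i, f q = ∑ q : LowIdx p, F q.1 := by
    rw [rowIdx, Finset.sum_filter]
    refine Finset.sum_congr rfl fun q _ => ?_
    simp [F, q.2]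
  rw [h1, ← Finset.sum_subtype (Finset.univ.filter fun q : Fin p × Fin p => q.2 ≤ q.1)
    (by simp) F, Finset.sum_filter, Fintype.sum_prod_type]
  symm
  rw [Finset.sum_eq_single i]
  · refine Finset.sum_congr rfl fun j _ => ?_
    by_cases h : j ≤ i <;> simp [F, h]
  · intro k _ hk
    exact Finset.sum_eq_zero fun j _ => by simp [F, hk]
  · simp

lemma lowMat_mul_row {p : ℕ} (t : LowIdx p → ℝ) (z : Fin p → ℝ) (i : Fin p) :
    ∑ j, lowMat p t i j * z j =
      ∑ q ∈ (rowIdx i).erase (diagIdx i), t q * z q.1.2 + t (diagIdx i) * z i := by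
  have he := Finset.sum_erase_add _ (fun q : LowIdx p => t q * z q.1.2) (diagIdx_mem_rowIdx i)
  rw [← sum_dite_le_eq_sum_rowIdx] at he
  refine Eq.trans ?_ he.symm
  refine Finset.sum_congr rfl fun j _ => ?_
  by_cases h : j ≤ i <;> simp [lowMat, h]

lemma sum_rowIdx_erase_diagIdx {p : ℕ} (w : ℕ → ℝ) (i : Fin p) :
    ∑ q ∈ (rowIdx i).erase (diagIdx i), w q.1.2 = ∑ j ∈ Finset.range i, w j := by
  have h := sum_dite_le_eq_sum_rowIdx (fun q : LowIdx p => w q.1.2) i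
  rw [← Finset.sum_erase_add _ _ (diagIdx_mem_rowIdx i)] at h
  have h2 : (∑ j : Fin p, if _h : j ≤ i then w j else 0) = ∑ j ∈ Finset.range (i + 1), w j := by
    simp only [dite_eq_ite, Fin.le_def]
    rw [Fin.sum_univ_eq_sum_range (fun k => if k ≤ (i : ℕ) then w k else 0) p,
      ← Finset.sum_filter]
    congr 1
    ext k
    simp only [Finset.mem_filter, Finset.mem_range]
    omega
  rw [h2, Finset.sum_range_succ] at h
  exact (add_right_cancel h).symm

section LowTriLaw

variable {p : ℕ} {m : ℝ}

lemma shape_pos (hm : 0 < m) (i : Fin p) : 0 < (m + (p : ℝ) - ((i : ℕ) + 1)) / 2 := by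
  have : ((i : ℕ) : ℝ) + 1 ≤ p := by exact_mod_cast i.2
  linarith

lemma lowEntryLaw_diagIdx (i : Fin p) : lowEntryLaw p m (diagIdx i) =
    Measure.map Real.sqrt (gammaMeasure ((m + (p : ℝ) - ((i : ℕ) + 1)) / 2) (1 / 2)) :=
  if_pos rfl

lemma isProbabilityMeasure_lowEntryLaw (hm : 0 < m) (q : LowIdx p) :
    IsProbabilityMeasure (lowEntryLaw p m q) := by
  unfold lowEntryLaw
  split_ifs
  · have := isProbabilityMeasure_gammaMeasure (shape_pos hm q.1.1) (one_half_pos (α := ℝ))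
    exact Measure.isProbabilityMeasure_map (by fun_prop)
  · infer_instance

lemma isProbabilityMeasure_lowTriLaw (hm : 0 < m) : IsProbabilityMeasure (lowTriLaw p m) := by
  have := isProbabilityMeasure_lowEntryLaw (p := p) hm
  rw [lowTriLaw_eq_pi]
  infer_instance

lemma measurePreserving_eval_lowTriLaw (hm : 0 < m) (q : LowIdx p) :
    MeasurePreserving (Function.eval q) (lowTriLaw p m) (lowEntryLaw p m q) := by
  have := isProbabilityMeasure_lowEntryLaw (p := p) hm
  exact measurePreserving_eval (lowEntryLaw p m) q

lemma integral_pow_eval_lowTriLaw (hm : 0 < m) (q : LowIdx p) (k : ℕ) :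
    ∫ t, t q ^ k ∂lowTriLaw p m = ∫ x, x ^ k ∂lowEntryLaw p m q := by
  rw [← (measurePreserving_eval_lowTriLaw hm q).map_eq,
    integral_map (measurable_pi_apply q).aemeasurable (by fun_prop)]

lemma integrable_pow_lowEntryLaw (hm : 0 < m) (q : LowIdx p) (k : ℕ) :
    Integrable (fun x : ℝ => x ^ k) (lowEntryLaw p m q) := by
  unfold lowEntryLaw
  split_ifs
  · exact integrable_pow_map_sqrt_gammaMeasure (shape_pos hm q.1.1) one_half_pos k
  · exact integrable_pow_gaussianReal 0 1 k

lemma integrable_pow_eval_lowTriLaw (hm : 0 < m) (q : LowIdx p) (k : ℕ) :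
    Integrable (fun t => t q ^ k) (lowTriLaw p m) :=
  (measurePreserving_eval_lowTriLaw hm q).integrable_comp_of_integrable
    (integrable_pow_lowEntryLaw hm q k)

lemma hasGaussianMoments_eval_lowTriLaw (hm : 0 < m) {q : LowIdx p} (hq : q.1.2 ≠ q.1.1) :
    HasGaussianMoments (fun t : LowIdx p → ℝ => t q) 1 (lowTriLaw p m) := by
  obtain ⟨h1, h2, h3, h4⟩ := integral_pow_gaussianReal_zero_one
  have hl : lowEntryLaw p m q = gaussianReal 0 1 := if_neg hq
  have hi := integral_pow_eval_lowTriLaw (p := p) hm q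
  rw [hl] at hi
  refine ⟨integrable_pow_eval_lowTriLaw hm q, ?_, ?_, ?_, ?_⟩
  · simpa [h1] using hi 1
  · rw [hi, h2]
  · rw [hi, h3]
  · rw [hi, h4]; norm_num

lemma iIndepFun_eval_mul_lowTriLaw (hm : 0 < m) (a : LowIdx p → ℝ) :
    iIndepFun (fun q (t : LowIdx p → ℝ) => t q * a q) (lowTriLaw p m) := by
  have := isProbabilityMeasure_lowEntryLaw (p := p) hm
  rw [lowTriLaw_eq_pi]
  exact iIndepFun_pi (X := fun q x => x * a q) fun q => by fun_prop

lemma indepFun_sum_mul_lowTriLaw (hm : 0 < m) {S S' : Finset (LowIdx p)} (h : Disjoint S S')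
    (a b : LowIdx p → ℝ) :
    IndepFun (fun t => ∑ q ∈ S, t q * a q) (fun t => ∑ q ∈ S', t q * b q) (lowTriLaw p m) := by
  have hi : iIndepFun (fun q (t : LowIdx p → ℝ) => t q) (lowTriLaw p m) := by
    simpa using iIndepFun_eval_mul_lowTriLaw hm (fun _ : LowIdx p => 1)
  have hST := hi.indepFun_finset S S' h fun q => measurable_pi_apply q
  have := hST.comp (φ := fun x => ∑ q : S, x q * a q) (ψ := fun x => ∑ q : S', x q * b q)
    (by fun_prop) (by fun_prop)
  convert this using 2 with t t
  · exact (Finset.sum_coe_sort S fun q => t q * a q).symm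
  · exact (Finset.sum_coe_sort S' fun q => t q * b q).symm

/-- The contribution of the strictly lower triangular entries to row `i` of `T z`. -/
lemma hasGaussianMoments_strictRow (hm : 0 < m) (z : Fin p → ℝ) (w : ℕ → ℝ)
    (hw : ∀ i : Fin p, w i = z i ^ 2) (i : Fin p) :
    HasGaussianMoments (fun t : LowIdx p → ℝ =>
      ∑ q ∈ (rowIdx i).erase (diagIdx i), t q * z q.1.2) (∑ j ∈ Finset.range i, w j)
      (lowTriLaw p m) := by
  have := isProbabilityMeasure_lowTriLaw (p := p) hm
  rw [← sum_rowIdx_erase_diagIdx w i]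
  refine HasGaussianMoments.finsetSum (fun q => by fun_prop)
    (iIndepFun_eval_mul_lowTriLaw hm fun q => z q.1.2) _ fun q hq => ?_
  rw [hw, ← one_mul (z q.1.2 ^ 2)]
  refine (hasGaussianMoments_eval_lowTriLaw hm fun h => ?_).mul_const _
  obtain ⟨hne, hmem⟩ := Finset.mem_erase.1 hq
  have h1 : q.1.1 = i := by simpa [rowIdx] using hmem
  exact hne (Subtype.ext (Prod.ext h1 (h.trans h1)))

/-- The moments of row `i` of `T z`. -/
lemma row_moments_lowTriLaw (hm : 0 < m) (z : Fin p → ℝ) (w : ℕ → ℝ)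
    (hw : ∀ i : Fin p, w i = z i ^ 2) (i : Fin p) :
    (∀ k : ℕ, Integrable (fun t => (∑ j, lowMat p t i j * z j) ^ k) (lowTriLaw p m)) ∧
    (∫ t, (∑ j, lowMat p t i j * z j) ^ 2 ∂lowTriLaw p m =
      ∑ j ∈ Finset.range i, w j + (m + p - 1 - i) * w i) ∧
    (∫ t, (∑ j, lowMat p t i j * z j) ^ 4 ∂lowTriLaw p m =
      3 * (∑ j ∈ Finset.range i, w j) ^ 2 +
        6 * (∑ j ∈ Finset.range i, w j) * ((m + p - 1 - i) * w i) +
        (m + p - 1 - i) * (m + p - 1 - i + 2) * w i ^ 2) := by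
  have := isProbabilityMeasure_lowTriLaw (p := p) hm
  have hG := hasGaussianMoments_strictRow hm z w hw i
  have hR := integrable_pow_eval_lowTriLaw hm (diagIdx i)
  have hdisj : Disjoint ((rowIdx i).erase (diagIdx i)) {diagIdx i} := by simp
  have hind := indepFun_sum_mul_lowTriLaw hm hdisj (fun q => z q.1.2) (fun _ => 1)
  have hindc := indepFun_sum_mul_lowTriLaw hm hdisj (fun q => z q.1.2) (fun _ => z i)
  simp only [Finset.sum_singleton, mul_one] at hind hindc
  have h2 : ∫ t, t (diagIdx i) ^ 2 ∂lowTriLaw p m = m + p - 1 - i := by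
    rw [integral_pow_eval_lowTriLaw hm, lowEntryLaw_diagIdx,
      integral_sq_map_sqrt_gammaMeasure (shape_pos hm i) one_half_pos]
    ring
  have h4 : ∫ t, t (diagIdx i) ^ 4 ∂lowTriLaw p m =
      (m + p - 1 - i) * (m + p - 1 - i + 2) := by
    rw [integral_pow_eval_lowTriLaw hm, lowEntryLaw_diagIdx,
      integral_pow_four_map_sqrt_gammaMeasure (shape_pos hm i) one_half_pos]
    ring
  simp only [lowMat_mul_row]
  refine ⟨hindc.integrable_add_pow hG.integrable_pow fun k => ?_, ?_, ?_⟩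
  · simpa only [mul_pow] using (hR k).mul_const _
  · rw [hG.integral_add_mul_sq hR hind h2, hw]
  · rw [hG.integral_add_mul_pow_four hR hind h2 h4, hw]
    ring

lemma pairwise_indepFun_row_lowTriLaw (hm : 0 < m) (z : Fin p → ℝ) :
    Pairwise fun i j : Fin p => IndepFun (fun t => (∑ k, lowMat p t i k * z k) ^ 2)
      (fun t => (∑ k, lowMat p t j k * z k) ^ 2) (lowTriLaw p m) := by
  have hrow : ∀ (i : Fin p) (t : LowIdx p → ℝ),
      ∑ k, lowMat p t i k * z k = ∑ q ∈ rowIdx i, t q * z q.1.2 := fun i t => by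
    rw [lowMat_mul_row, ← Finset.sum_erase_add _ _ (diagIdx_mem_rowIdx i)]
    rfl
  intro i j hij
  simp only [hrow]
  exact (indepFun_sum_mul_lowTriLaw hm (disjoint_rowIdx hij) (fun q => z q.1.2)
    (fun q => z q.1.2)).comp (φ := (· ^ 2)) (ψ := (· ^ 2)) (by fun_prop) (by fun_prop)

lemma integral_sum_row_sq_sq_lowTriLaw (hm : 0 < m) (z : Fin p → ℝ) (w : ℕ → ℝ)
    (hw : ∀ i : Fin p, w i = z i ^ 2) :
    ∫ t, (∑ i, (∑ j, lowMat p t i j * z j) ^ 2) ^ 2 ∂lowTriLaw p m =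
      ((m + 2 * p - 2) * ∑ i ∈ Finset.range p, w i - 2 * ∑ i ∈ Finset.range p, i * w i) ^ 2 +
      2 * ((m + 2 * p - 2) * (∑ i ∈ Finset.range p, w i) ^ 2 -
        2 * ∑ i ∈ Finset.range p, ∑ j ∈ Finset.range p, ((max i j : ℕ) : ℝ) * w i * w j) := by
  have := isProbabilityMeasure_lowTriLaw (p := p) hm
  have hmom := row_moments_lowTriLaw hm z w hw
  have hL : ∀ i : Fin p, MemLp (fun t => (∑ j, lowMat p t i j * z j) ^ 2) 2 (lowTriLaw p m) := by
    intro i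
    rw [memLp_two_iff_integrable_sq ((hmom i).1 2).aestronglyMeasurable]
    simpa only [← pow_mul] using (hmom i).1 4
  rw [integral_sum_sq_of_pairwise_indepFun hL (pairwise_indepFun_row_lowTriLaw hm z)]
  simp only [← pow_mul, Nat.reduceMul, (hmom _).2.1, (hmom _).2.2]
  have e1 := sum_range_partialSum_add (m + p - 1) w p
  have e2 := sum_range_partialSum_sq_add (m + p - 1) w p
  rw [show m + (p : ℝ) - 1 + p - 1 = m + 2 * p - 2 by ring] at e1 e2
  rw [← e1, ← e2, ← Fin.sum_univ_eq_sum_range, ← Fin.sum_univ_eq_sum_range, Finset.mul_sum]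
  congr 1
  refine Finset.sum_congr rfl fun i _ => ?_
  ring

end LowTriLaw

lemma sum_range_succ_weight (w : ℕ → ℝ) (n : ℕ) :
    ∑ i ∈ Finset.range n, ((i + 1 : ℕ) : ℝ) * w i =
      ∑ i ∈ Finset.range n, i * w i + ∑ i ∈ Finset.range n, w i := by
  rw [← Finset.sum_add_distrib]
  refine Finset.sum_congr rfl fun i _ => ?_
  push_cast
  ring

lemma sum_range_max_succ_weight (w : ℕ → ℝ) (n : ℕ) :
    ∑ i ∈ Finset.range n, ∑ j ∈ Finset.range n, ((max (i + 1) (j + 1) : ℕ) : ℝ) * w i * w j =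
      ∑ i ∈ Finset.range n, ∑ j ∈ Finset.range n, ((max i j : ℕ) : ℝ) * w i * w j +
        (∑ i ∈ Finset.range n, w i) ^ 2 := by
  rw [sq, Finset.sum_mul_sum, ← Finset.sum_add_distrib]
  refine Finset.sum_congr rfl fun i _ => ?_
  rw [← Finset.sum_add_distrib]
  refine Finset.sum_congr rfl fun j _ => ?_
  rw [Nat.add_max_add_right]
  push_cast
  ring

lemma sum_range_min_succ_weight (w : ℕ → ℝ) (n : ℕ) :
    ∑ i ∈ Finset.range n, ∑ j ∈ Finset.range n, ((min (i + 1) (j + 1) : ℕ) : ℝ) * w i * w j =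
      2 * (∑ i ∈ Finset.range n, w i) * (∑ i ∈ Finset.range n, ((i + 1 : ℕ) : ℝ) * w i) -
      ∑ i ∈ Finset.range n, ∑ j ∈ Finset.range n, ((max (i + 1) (j + 1) : ℕ) : ℝ) * w i * w j := by
  have h1 := Finset.sum_mul_sum (Finset.range n) (Finset.range n) w
    fun i => ((i + 1 : ℕ) : ℝ) * w i
  have h2 := Finset.sum_mul_sum (Finset.range n) (Finset.range n)
    (fun i => ((i + 1 : ℕ) : ℝ) * w i) w
  have hAB : ∀ A B : ℝ, 2 * A * B = A * B + B * A := fun A B => by ring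
  rw [eq_sub_iff_add_eq, hAB, h1, h2, ← Finset.sum_add_distrib,
    ← Finset.sum_add_distrib]
  refine Finset.sum_congr rfl fun i _ => ?_
  rw [← Finset.sum_add_distrib, ← Finset.sum_add_distrib]
  refine Finset.sum_congr rfl fun j _ => ?_
  have h : ((min (i + 1) (j + 1) : ℕ) : ℝ) + ((max (i + 1) (j + 1) : ℕ) : ℝ) =
      ((i + 1 : ℕ) : ℝ) + ((j + 1 : ℕ) : ℝ) := by
    exact_mod_cast min_add_max (i + 1) (j + 1)
  linear_combination w i * w j * h

/-- second moment of the triangular quadratic form.  For `T` random lower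
triangular as above and fixed `z ∈ ℝ^p` (indices 1-based),
`E[(z'T'Tz)²] = (m+2p+2)(m+2p)(∑ᵢ zᵢ²)² - 2(m+2p+2) ∑_{i,j} max(i,j) zᵢ²zⱼ²
  - 2(m+2p) ∑_{i,j} min(i,j) zᵢ²zⱼ² + 4 (∑ᵢ i zᵢ²)²`. -/
theorem triangular_quadratic_form_second_moment (p : ℕ) (hp : 1 ≤ p) (m : ℝ) (hm : 0 < m)
    {Ω : Type*} [MeasurableSpace Ω] (μ : Measure Ω) [IsProbabilityMeasure μ]
    (T : Ω → LowIdx p → ℝ)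
    (hT : Measure.map (fun ω => T ω) μ = lowTriLaw p m) (z : Fin p → ℝ) :
    (∫ ω, (∑ i, (∑ j, lowMat p (T ω) i j * z j) ^ 2) ^ 2 ∂μ)
      = (m + 2 * (p : ℝ) + 2) * (m + 2 * (p : ℝ)) * (∑ i, (z i) ^ 2) ^ 2
        - 2 * (m + 2 * (p : ℝ) + 2) *
            (∑ i : Fin p, ∑ j : Fin p, ((max ((i : ℕ) + 1) ((j : ℕ) + 1) : ℕ) : ℝ) * (z i) ^ 2 * (z j) ^ 2)
        - 2 * (m + 2 * (p : ℝ)) *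
            (∑ i : Fin p, ∑ j : Fin p, ((min ((i : ℕ) + 1) ((j : ℕ) + 1) : ℕ) : ℝ) * (z i) ^ 2 * (z j) ^ 2)
        + 4 * (∑ i : Fin p, (((i : ℕ) + 1 : ℕ) : ℝ) * (z i) ^ 2) ^ 2 := by
  let w : ℕ → ℝ := fun k => if h : k < p then z ⟨k, h⟩ ^ 2 else 0
  have hw : ∀ i : Fin p, w i = z i ^ 2 := fun i => by simp [w]
  have hP := isProbabilityMeasure_lowTriLaw (p := p) hm
  have hTm : AEMeasurable T μ := by
    by_contra h
    rw [Measure.map_of_not_aemeasurable h] at hT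
    exact hP.ne_zero _ hT.symm
  have hmeas : Measurable fun t : LowIdx p → ℝ => (∑ i, (∑ j, lowMat p t i j * z j) ^ 2) ^ 2 := by
    simp only [lowMat_mul_row]
    fun_prop
  rw [← integral_map (φ := T) hTm hmeas.aestronglyMeasurable, hT,
    integral_sum_row_sq_sq_lowTriLaw hm z w hw]
  simp only [← hw]
  have hmm : ∀ F : ℕ → ℕ → ℕ,
      ∑ i : Fin p, ∑ j : Fin p, ((F i j : ℕ) : ℝ) * w i * w j =
        ∑ i ∈ Finset.range p, ∑ j ∈ Finset.range p, ((F i j : ℕ) : ℝ) * w i * w j := fun F => by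
    rw [← Fin.sum_univ_eq_sum_range fun i => ∑ j ∈ Finset.range p, ((F i j : ℕ) : ℝ) * w i * w j]
    refine Finset.sum_congr rfl fun i _ => ?_
    exact Fin.sum_univ_eq_sum_range (fun j => ((F i j : ℕ) : ℝ) * w i * w j) p
  rw [hmm fun i j => max (i + 1) (j + 1), hmm fun i j => min (i + 1) (j + 1),
    Fin.sum_univ_eq_sum_range w p, Fin.sum_univ_eq_sum_range (fun i => ((i + 1 : ℕ) : ℝ) * w i) p,
    sum_range_min_succ_weight, sum_range_max_succ_weight, sum_range_succ_weight]
  ring
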